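/- Let H be a 2×2 Hermitian complex matrix whose diagonal entries are equal (H₀₀ = H₁₁) and whose off-diagonal entry has modulus h₂ = |H₀₁| > 0. Then for every C ∈ [0,1], the coherence-constrained maximal work satisfies ξ₂(C) = 2·h₂·C; in particular, ξ₂ increases linearly (hence strictly monotonically) with the coherence C. -/

import Mathlib

open Matrix BigOperators
open scoped ComplexOrder

/-- The l1-norm of coherence of a matrix in the standard basis. -/
noncomputable def coh {d : ℕ} (ρ : Matrix (Fin d) (Fin d) ℂ) : ℝ :=
  ∑ i, ∑ j, if i ≠ j then ‖ρ i j‖ else 0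

/-- A density matrix: positive semidefinite with unit trace. -/
def IsDensityMatrix {d : ℕ} (ρ : Matrix (Fin d) (Fin d) ℂ) : Prop :=
  ρ.PosSemidef ∧ ρ.trace = 1

/-- A unitary matrix. -/
def IsUnitaryMat {d : ℕ} (U : Matrix (Fin d) (Fin d) ℂ) : Prop :=
  U * Uᴴ = 1 ∧ Uᴴ * U = 1

/-- The coherence-constrained maximal work: the supremum of Tr[Hρ] − Tr[H UρU†]
over all density matrices ρ of coherence C and all unitaries U preserving that coherence. -/
noncomputable def ccmw (d : ℕ) (H : Matrix (Fin d) (Fin d) ℂ) (C : ℝ) : ℝ :=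
  sSup { w : ℝ | ∃ ρ U : Matrix (Fin d) (Fin d) ℂ,
    IsDensityMatrix ρ ∧ coh ρ = C ∧ IsUnitaryMat U ∧ coh (U * ρ * Uᴴ) = C ∧
    w = ((H * ρ).trace).re - ((H * (U * ρ * Uᴴ)).trace).re }

theorem IsDensityMatrix.unitary_conj {d : ℕ} {ρ U : Matrix (Fin d) (Fin d) ℂ}
    (hρ : IsDensityMatrix ρ) (hU : IsUnitaryMat U) : IsDensityMatrix (U * ρ * Uᴴ) := by
  refine ⟨hρ.1.mul_mul_conjTranspose_same U, ?_⟩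
  rw [Matrix.trace_mul_cycle, hU.2, one_mul, hρ.2]

theorem coh_fin_two {A : Matrix (Fin 2) (Fin 2) ℂ} (hA : A.IsHermitian) :
    coh A = 2 * ‖A 1 0‖ := by
  have h : ‖A 0 1‖ = ‖A 1 0‖ := by rw [← hA.apply 0 1, norm_star]
  simp [coh, Fin.sum_univ_two, h]
  ring

/-- For equal diagonal entries, the energy of a state depends only on its off-diagonal entry. -/
theorem re_trace_mul_fin_two {H A : Matrix (Fin 2) (Fin 2) ℂ} (hH : H.IsHermitian)
    (heq : H 0 0 = H 1 1) (hA : IsDensityMatrix A) :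
    ((H * A).trace).re = (H 0 0).re + 2 * (H 0 1 * A 1 0).re := by
  have htr : A 0 0 + A 1 1 = 1 := by simpa [Matrix.trace_fin_two] using hA.2
  have hoff : H 1 0 * A 0 1 = star (H 0 1 * A 1 0) := by
    rw [← hH.apply 1 0, ← hA.1.isHermitian.apply 0 1, star_mul, mul_comm]
  have key : (H * A).trace = H 0 0 + (H 0 1 * A 1 0 + star (H 0 1 * A 1 0)) := by
    rw [← hoff, Matrix.trace_fin_two, Matrix.mul_apply, Matrix.mul_apply,
      Fin.sum_univ_two, Fin.sum_univ_two, ← heq]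
    linear_combination H 0 0 * htr
  rw [key, Complex.add_re, Complex.add_re, Complex.star_def, Complex.conj_re]
  ring

/-- The qubit state with balanced populations, coherence `C` and phase `z`. -/
noncomputable def balancedQubit (C : ℝ) (z : ℂ) : Matrix (Fin 2) (Fin 2) ℂ :=
  !![1 / 2, C / 2 * z; C / 2 * star z, 1 / 2]

theorem isDensityMatrix_balancedQubit {C : ℝ} (hC : C ∈ Set.Icc (0 : ℝ) 1) {z : ℂ}
    (hz : ‖z‖ = 1) : IsDensityMatrix (balancedQubit C z) := by
  have hz' : z * star z = 1 := by
    rw [Complex.star_def, Complex.mul_conj, Complex.normSq_eq_norm_sq, hz]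
    norm_num
  have hsum : balancedQubit C z = ((1 - C) / 2) • (1 : Matrix (Fin 2) (Fin 2) ℂ) +
      (C / 2) • vecMulVec ![z, 1] (star ![z, 1]) := by
    ext i j
    fin_cases i <;> fin_cases j <;> simp [balancedQubit, vecMulVec_apply, -cons_vecMulVec] <;>
      simp only [Complex.star_def] at hz' <;> try rw [hz']
    all_goals ring
  refine ⟨?_, ?_⟩
  · rw [hsum]
    exact (PosSemidef.one.smul (by linarith [hC.2])).add
      ((posSemidef_vecMulVec_self_star _).smul (by linarith [hC.1]))
  · norm_num [balancedQubit, Matrix.trace_fin_two]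

/-- Flipping the relative phase of the two basis states. -/
theorem isUnitaryMat_phaseFlip :
    IsUnitaryMat (!![1, 0; 0, -1] : Matrix (Fin 2) (Fin 2) ℂ) := by
  constructor <;> ext i j <;> fin_cases i <;> fin_cases j <;> simp [Matrix.mul_apply]

theorem phaseFlip_conj_apply_one_zero (A : Matrix (Fin 2) (Fin 2) ℂ) :
    ((!![1, 0; 0, -1] : Matrix (Fin 2) (Fin 2) ℂ) * A *
      (!![1, 0; 0, -1] : Matrix (Fin 2) (Fin 2) ℂ)ᴴ) 1 0 = -A 1 0 := by
  simp [Matrix.mul_apply, Matrix.vecMul, dotProduct, Fin.sum_univ_two]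

theorem ccmw_fin_two_of_diag_eq {H : Matrix (Fin 2) (Fin 2) ℂ} (hH : H.IsHermitian)
    (heq : H 0 0 = H 1 1) (hpos : 0 < ‖H 0 1‖) {C : ℝ} (hC : C ∈ Set.Icc (0 : ℝ) 1) :
    ccmw 2 H C = 2 * ‖H 0 1‖ * C := by
  refine IsGreatest.csSup_eq ⟨?_, ?_⟩
  · have hz : ‖H 0 1 / (‖H 0 1‖ : ℂ)‖ = 1 := by
      rw [norm_div, Complex.norm_real, norm_norm, div_self hpos.ne']
    have hρ := isDensityMatrix_balancedQubit hC hz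
    have hσ := hρ.unitary_conj isUnitaryMat_phaseFlip
    have hcoh : coh (balancedQubit C (H 0 1 / (‖H 0 1‖ : ℂ))) = C := by
      rw [coh_fin_two hρ.1.isHermitian]
      change 2 * ‖(C / 2 * star (H 0 1 / (‖H 0 1‖ : ℂ)) : ℂ)‖ = C
      rw [norm_mul, norm_star, hz, norm_div, Complex.norm_real, Real.norm_of_nonneg hC.1]
      norm_num
      ring
    refine ⟨_, _, hρ, hcoh, isUnitaryMat_phaseFlip, ?_, ?_⟩
    · rw [coh_fin_two hσ.1.isHermitian, phaseFlip_conj_apply_one_zero, norm_neg,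
        ← coh_fin_two hρ.1.isHermitian, hcoh]
    · rw [re_trace_mul_fin_two hH heq hρ, re_trace_mul_fin_two hH heq hσ,
        phaseFlip_conj_apply_one_zero]
      have hoff : H 0 1 * balancedQubit C (H 0 1 / (‖H 0 1‖ : ℂ)) 1 0
          = ((‖H 0 1‖ * C / 2 : ℝ) : ℂ) := by
        change H 0 1 * (C / 2 * star (H 0 1 / (‖H 0 1‖ : ℂ))) = _
        have hne : (‖H 0 1‖ : ℂ) ≠ 0 := by exact_mod_cast hpos.ne'
        have hmul := Complex.mul_conj' (H 0 1)
        rw [Complex.star_def, map_div₀, Complex.conj_ofReal]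
        push_cast
        field_simp
        linear_combination (C : ℂ) * hmul
      rw [mul_neg, hoff, Complex.neg_re, Complex.ofReal_re]
      ring
  · rintro w ⟨ρ, U, hρ, hCρ, hU, hCσ, rfl⟩
    have hσ := hρ.unitary_conj hU
    rw [re_trace_mul_fin_two hH heq hρ, re_trace_mul_fin_two hH heq hσ]
    rw [coh_fin_two hρ.1.isHermitian] at hCρ
    rw [coh_fin_two hσ.1.isHermitian] at hCσ
    have h₁ := (abs_le.mp (Complex.abs_re_le_norm (H 0 1 * ρ 1 0))).2
    have h₂ := (abs_le.mp (Complex.abs_re_le_norm (H 0 1 * (U * ρ * Uᴴ) 1 0))).1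
    rw [norm_mul] at h₁ h₂
    linear_combination 2 * h₁ + 2 * h₂ + ‖H 0 1‖ * hCρ + ‖H 0 1‖ * hCσ

theorem stmt3 (H : Matrix (Fin 2) (Fin 2) ℂ) (hH : H.IsHermitian)
    (heq : H 0 0 = H 1 1) (hpos : 0 < ‖H 0 1‖) :
    (∀ C ∈ Set.Icc (0 : ℝ) 1, ccmw 2 H C = 2 * ‖H 0 1‖ * C) ∧
    StrictMonoOn (ccmw 2 H) (Set.Icc (0 : ℝ) 1) := by
  refine ⟨fun C hC => ccmw_fin_two_of_diag_eq hH heq hpos hC, fun a ha b hb hab => ?_⟩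
  rw [ccmw_fin_two_of_diag_eq hH heq hpos ha, ccmw_fin_two_of_diag_eq hH heq hpos hb]
  exact mul_lt_mul_of_pos_left hab (by positivity)
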